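/- arXiv:1812.02067 — 4 statements merged into one kernel-verified Lean document; each statement's English description precedes it below -/
import Mathlib

section
/- For every integer k ≥ 2, the subsequence (v_{kn})_{n≥0} of the word vtm contains the square 00 or the square 22; that is, there exists n ≥ 0 such that v_{kn} = v_{k(n+1)} and this common value is 0 or 2. -/
/-- The morphism μ : 0 ↦ 012, 1 ↦ 02, 2 ↦ 1. -/
def mu : Fin 3 → List (Fin 3)
  | 0 => [0, 1, 2]
  | 1 => [0, 2]
  | 2 => [1]

/-- Apply μ to a finite word. -/
def muWord (l : List (Fin 3)) : List (Fin 3) := l.flatMap mu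

/-- The word vtm = 012021012102012⋯, the fixed point of μ starting with 0,
obtained as the limit of μ^n(0): since μ^m(0) is a prefix of μ^(m+1)(0) and
its length exceeds n for m = n+1, the n-th letter is read off from μ^(n+1)(0). -/
def vtm (n : ℕ) : Fin 3 := ((muWord^[n + 1]) [0]).getD n 0

/-- The Thue-Morse sequence. -/
def tm : ℕ → Bool
  | 0 => false
  | n + 1 => xor (decide ((n + 1) % 2 = 1)) (tm ((n + 1) / 2))
decreasing_by omega

theorem tm_zero : tm 0 = false := by rw [tm]

theorem tm_even (n : ℕ) : tm (2 * n) = tm n := by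
  rcases n with _ | n
  · rfl
  · have h : 2 * (n + 1) = (2 * n + 1) + 1 := by ring
    rw [h, tm]
    have h1 : (2 * n + 1 + 1) % 2 = 0 := by omega
    have h2 : (2 * n + 1 + 1) / 2 = n + 1 := by omega
    rw [h1, h2]; simp

theorem tm_odd (n : ℕ) : tm (2 * n + 1) = !tm n := by
  rw [tm]
  have h1 : (2 * n + 1) % 2 = 1 := by omega
  have h2 : (2 * n + 1) / 2 = n := by omega
  rw [h1, h2]; simp

theorem tm_add (N : ℕ) : ∀ q s : ℕ, s < 2 ^ N → tm (2 ^ N * q + s) = xor (tm q) (tm s) := by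
  induction N with
  | zero =>
    intro q s hs
    have : s = 0 := by simpa using hs
    subst this
    simp [tm_zero]
  | succ N ih =>
    intro q s hs
    rw [pow_succ] at hs
    rcases Nat.even_or_odd' s with ⟨c, rfl | rfl⟩
    · have h : 2 ^ (N + 1) * q + 2 * c = 2 * (2 ^ N * q + c) := by ring
      rw [h, tm_even, tm_even, ih q c (by omega)]
    · have h : 2 ^ (N + 1) * q + (2 * c + 1) = 2 * (2 ^ N * q + c) + 1 := by ring
      rw [h, tm_odd, tm_odd, ih q c (by omega)]
      simp

/-- Letter of vtm computed from Thue-Morse. -/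
def wl (n : ℕ) : Fin 3 := if tm n = tm (n + 1) then 1 else if tm n then 2 else 0

/-- Length of the image of the prefix of length n. -/
def ll (n : ℕ) : ℕ := 2 * n + (tm n).toNat

theorem muWord_prefix (n : ℕ) :
    muWord ((List.range n).map wl) = (List.range (ll n)).map wl := by
  induction n with
  | zero => simp [muWord, ll, tm_zero]
  | succ n ih =>
    have e : muWord ((List.range (n + 1)).map wl)
        = muWord ((List.range n).map wl) ++ mu (wl n) := by
      simp [muWord, List.range_succ]
    rw [e, ih]
    have a0 := tm_even n
    have a1 := tm_odd n
    have a2 : tm (2 * n + 2) = tm (n + 1) := tm_even (n + 1)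
    have a3 : tm (2 * n + 3) = !tm (n + 1) := tm_odd (n + 1)
    rcases h0 : tm n <;> rcases h1 : tm (n + 1) <;> rw [h0] at a0 a1 <;> rw [h1] at a2 a3
    · have l : ll (n + 1) = ll n + 2 := by simp [ll, h0, h1]; ring
      rw [l]
      simp [List.range_succ, ll, wl, mu, h0, h1, a0, a1, a2, a3]
    · have l : ll (n + 1) = ll n + 3 := by simp [ll, h0, h1]; ring
      rw [l]
      simp [List.range_succ, ll, wl, mu, h0, h1, a0, a1, a2, a3]
    · have l : ll (n + 1) = ll n + 1 := by simp [ll, h0, h1]; ring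
      rw [l]
      simp [List.range_succ, ll, wl, mu, h0, h1, a0, a1, a2, a3]
    · have l : ll (n + 1) = ll n + 2 := by simp [ll, h0, h1]; ring
      rw [l]
      simp [List.range_succ, ll, wl, mu, h0, h1, a0, a1, a2, a3]

theorem iter_eq (i : ℕ) :
    ∃ L, i < L ∧ (muWord^[i]) [0] = (List.range L).map wl := by
  induction i with
  | zero => exact ⟨1, by norm_num, by simp [wl, tm]⟩
  | succ i ih =>
    obtain ⟨L, hL, h⟩ := ih
    refine ⟨ll L, by unfold ll; omega, ?_⟩
    rw [Function.iterate_succ_apply', h, muWord_prefix]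

theorem vtm_eq (n : ℕ) : vtm n = wl n := by
  obtain ⟨L, hL, h⟩ := iter_eq (n + 1)
  have hn : n < L := by omega
  simp [vtm, h, List.getD, hn]

theorem finish (x y : ℕ) (h : tm x = tm y) (hx : tm (x + 1) = !tm x) (hy : tm (y + 1) = !tm y) :
    vtm x = vtm y ∧ (vtm x = 0 ∨ vtm x = 2) := by
  rw [vtm_eq, vtm_eq]
  unfold wl
  rw [hx, hy, ← h]
  cases tm x <;> simp

/-- It is enough to find the square at any position, when k is odd. -/
theorem shift (k m : ℕ) (hk : Odd k) (h : tm m = tm (m + k)) (hx : tm (m + 1) = !tm m)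
    (hy : tm (m + k + 1) = !tm (m + k)) :
    ∃ n : ℕ, vtm (k * n) = vtm (k * (n + 1)) ∧ (vtm (k * n) = 0 ∨ vtm (k * n) = 2) := by
  obtain ⟨N, hN⟩ : ∃ N, m + k + 1 < 2 ^ N := ⟨m + k + 1, Nat.lt_two_pow_self⟩
  have hc : Nat.Coprime k (2 ^ N) := (Nat.coprime_two_right.mpr hk).pow_right N
  have hlt : 1 < 2 ^ N := by omega
  obtain ⟨c, hc'⟩ := Nat.exists_mul_mod_eq_one_of_coprime hc hlt
  have hmod : k * (c * m) % 2 ^ N = m := by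
    rw [← mul_assoc, Nat.mul_mod, hc'.2, one_mul, Nat.mod_mod, Nat.mod_eq_of_lt (by omega)]
  refine ⟨c * m, ?_⟩
  have hd := Nat.div_add_mod (k * (c * m)) (2 ^ N)
  rw [hmod] at hd
  have e2 : k * (c * m + 1) = k * (c * m) + k := by ring
  rw [e2, ← hd]
  generalize k * (c * m) / 2 ^ N = q
  apply finish
  · rw [add_assoc, tm_add _ _ _ (by omega), tm_add _ _ _ (by omega), h]
  · rw [add_assoc, tm_add _ _ _ (by omega), tm_add _ _ _ (by omega), hx]; simp
  · rw [add_assoc (2 ^ N * q) m k, add_assoc (2 ^ N * q) (m + k) 1, tm_add _ _ _ (by omega),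
      tm_add _ _ _ (by omega), hy]
    simp

theorem odd_case (k : ℕ) (hk : Odd k) (h5 : 5 ≤ k) :
    ∃ m, tm m = tm (m + k) ∧ tm (m + 1) = !tm m ∧ tm (m + k + 1) = !tm (m + k) := by
  obtain ⟨j, rfl⟩ := hk
  obtain ⟨N, hN⟩ : ∃ N, 2 * j + 1 < 2 ^ N := ⟨2 * j + 1, Nat.lt_two_pow_self⟩
  have t0 := tm_zero
  have t1 : tm 1 = true := by simp [tm]
  have t2 : tm 2 = true := by simp [tm]
  have t3 : tm 3 = false := by simp [tm]
  have t4 : tm 4 = true := by simp [tm]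
  -- the low part of m
  obtain ⟨N', rfl⟩ : ∃ N', N = N' + 1 := by
    rcases N with _ | N
    · simp at hN
    · exact ⟨N, rfl⟩
  obtain ⟨s, hs⟩ : ∃ s, 2 * s + (2 * j + 1) = 2 ^ (N' + 1) + 3 := by
    refine ⟨2 ^ N' + 1 - j, ?_⟩
    rw [pow_succ] at hN ⊢
    omega
  have key : ∀ x : ℕ, tm (2 ^ (N' + 1) * x + 2 * s) = xor (tm x) (tm s) ∧
      tm (2 ^ (N' + 1) * x + 2 * s + 1) = !(xor (tm x) (tm s)) ∧
      tm (2 ^ (N' + 1) * x + 2 * s + (2 * j + 1)) = tm (x + 1) ∧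
      tm (2 ^ (N' + 1) * x + 2 * s + (2 * j + 1) + 1) = !tm (x + 1) := by
    intro x
    have e : 2 ^ (N' + 1) * x + 2 * s + (2 * j + 1) = 2 ^ (N' + 1) * (x + 1) + 3 := by
      rw [add_assoc, hs]; ring
    refine ⟨?_, ?_, ?_, ?_⟩
    · rw [tm_add _ _ _ (by omega), tm_even]
    · rw [add_assoc, tm_add _ _ _ (by omega), tm_odd]; simp
    · rw [e, tm_add _ _ _ (by omega), t3]; simp
    · rw [e, add_assoc, tm_add _ _ _ (by omega), t4]; simp
  rcases hb : tm s
  · refine ⟨2 ^ (N' + 1) * 1 + 2 * s, ?_⟩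
    obtain ⟨a, b, c, d⟩ := key 1
    rw [a, b, c, d, hb, t1, t2]; simp
  · refine ⟨2 ^ (N' + 1) * 0 + 2 * s, ?_⟩
    obtain ⟨a, b, c, d⟩ := key 0
    rw [a, b, c, d, hb, t0, t1]; simp

/-- For every k ≥ 2, the subsequence (v_{kn}) contains the square 00 or 22. -/
theorem vtm_subseq_square_00_or_22 (k : ℕ) (hk : 2 ≤ k) :
    ∃ n : ℕ, vtm (k * n) = vtm (k * (n + 1)) ∧ (vtm (k * n) = 0 ∨ vtm (k * n) = 2) := by
  rcases Nat.even_or_odd' k with ⟨j, hj | hj⟩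
  · rcases h : tm k
    · refine ⟨0, finish _ _ ?_ ?_ ?_⟩
      · simp [h, tm_zero]
      · simp [tm]
      · simp only [zero_add, mul_one]
        rw [hj, tm_odd, tm_even]
    · refine ⟨1, finish _ _ ?_ ?_ ?_⟩
      · rw [mul_one, mul_comm k, tm_even]
      · rw [mul_one, hj, tm_odd, tm_even]
      · rw [mul_comm k, tm_odd, tm_even]
  · by_cases h5 : 5 ≤ k
    · obtain ⟨m, h1, h2, h3⟩ := odd_case k ⟨j, hj⟩ h5
      exact shift k m ⟨j, hj⟩ h1 h2 h3
    · have : k = 3 := by omega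
      subst this
      exact ⟨0, finish _ _ (by simp [tm]) (by simp [tm]) (by simp [tm])⟩
end

section
/- The word vtm is squarefree: there do not exist indices i ≥ 0 and L ≥ 1 such that v_{i+j} = v_{i+L+j} for all 0 ≤ j < L. -/
/-- The Thue–Morse sequence. -/
def tmSeq (n : ℕ) : Bool :=
  if h : n = 0 then false else xor (decide (n % 2 = 1)) (tmSeq (n / 2))
termination_by n
decreasing_by omega

theorem tmSeq_even (n : ℕ) : tmSeq (2 * n) = tmSeq n := by
  by_cases h : n = 0
  · subst h; rfl
  · rw [tmSeq, dif_neg (by omega)]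
    simp

theorem tmSeq_odd (n : ℕ) : tmSeq (2 * n + 1) = !tmSeq n := by
  rw [tmSeq, dif_neg (by omega)]
  have h1 : (2 * n + 1) % 2 = 1 := by omega
  have h2 : (2 * n + 1) / 2 = n := by omega
  simp [h1, h2]

theorem tmSeq_ne {n : ℕ} (h : n % 2 = 0) : tmSeq (n + 1) = !tmSeq n := by
  obtain ⟨k, rfl⟩ : ∃ k, n = 2 * k := ⟨n / 2, by omega⟩
  rw [tmSeq_odd, tmSeq_even]

theorem tmSeq_overlapfree (L : ℕ) : 1 ≤ L → ∀ i : ℕ,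
    (∀ j ≤ L, tmSeq (i + j) = tmSeq (i + L + j)) → False := by
  induction L using Nat.strong_induction_on with
  | _ L ih =>
    intro hL i h
    rcases Nat.even_or_odd' L with ⟨k, hk | hk⟩
    · refine ih k (by omega) (by omega) (i / 2) ?_
      intro j hj
      have h1 := h (2 * j) (by omega)
      rcases Nat.even_or_odd' i with ⟨q, hq | hq⟩
      · have e : i / 2 = q := by omega
        rw [e]
        rw [show i + 2 * j = 2 * (q + j) by omega,
          show i + L + 2 * j = 2 * (q + k + j) by omega, tmSeq_even, tmSeq_even] at h1
        exact h1
      · have e : i / 2 = q := by omega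
        rw [e]
        rw [show i + 2 * j = 2 * (q + j) + 1 by omega,
          show i + L + 2 * j = 2 * (q + k + j) + 1 by omega, tmSeq_odd, tmSeq_odd] at h1
        exact Bool.not_inj h1
    · -- alternation on the first period
      have alt : ∀ j < L, tmSeq (i + j + 1) = !tmSeq (i + j) := by
        intro j hj
        by_cases hp : (i + j) % 2 = 0
        · exact tmSeq_ne hp
        · have h1 := h j (by omega)
          have h2 := h (j + 1) (by omega)
          have h3 := tmSeq_ne (n := i + L + j) (by omega)
          rw [← add_assoc, ← add_assoc] at h2
          rw [h1, h2, h3]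
      have par : ∀ j ≤ L, tmSeq (i + j) = xor (decide (j % 2 = 1)) (tmSeq i) := by
        intro j
        induction j with
        | zero => intro _; simp
        | succ j ihj =>
          intro hj
          rw [← add_assoc, alt j (by omega), ihj (by omega)]
          rcases Nat.mod_two_eq_zero_or_one j with e | e
          · have e' : (j + 1) % 2 = 1 := by omega
            simp [e, e']
          · have e' : (j + 1) % 2 = 0 := by omega
            simp [e, e']
      have h0 := h 0 (by omega)
      have hLL := par L le_rfl
      have e : L % 2 = 1 := by omega
      simp only [add_zero] at h0
      rw [← h0] at hLL
      simp [e] at hLL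

/-- The Thue–Morse morphism. -/
def theta (l : List Bool) : List Bool := l.flatMap fun b => [b, !b]

/-- The coding `0 ↦ 011`, `1 ↦ 01`, `2 ↦ 0`. -/
def hCode : Fin 3 → List Bool
  | 0 => [false, true, true]
  | 1 => [false, true]
  | 2 => [false]

/-- The coding on words. -/
def hWord (l : List (Fin 3)) : List Bool := l.flatMap hCode

theorem theta_map (n : ℕ) :
    theta ((List.range n).map tmSeq) = (List.range (2 * n)).map tmSeq := by
  induction n with
  | zero => rfl
  | succ n ih =>
    rw [List.range_succ, show 2 * (n + 1) = 2 * n + 1 + 1 by omega, List.range_succ,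
      List.range_succ]
    simp only [List.map_append, ← ih, theta, List.flatMap_append]
    simp [tmSeq_even, tmSeq_odd]

theorem hWord_mu (a : Fin 3) : hWord (mu a) = theta (hCode a) := by
  fin_cases a <;> rfl

theorem hWord_append (l m : List (Fin 3)) : hWord (l ++ m) = hWord l ++ hWord m :=
  List.flatMap_append

theorem hWord_muWord (l : List (Fin 3)) : hWord (muWord l) = theta (hWord l) := by
  induction l with
  | nil => rfl
  | cons a l ih =>
    have e1 : muWord (a :: l) = mu a ++ muWord l := rfl
    have e2 : hWord (a :: l) = hCode a ++ hWord l := rfl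
    rw [e1, e2, hWord_append, ih, hWord_mu]
    simp [theta]

theorem hWord_iter (m : ℕ) :
    ∃ N, hWord (muWord^[m] [0]) = (List.range N).map tmSeq := by
  induction m with
  | zero =>
    refine ⟨3, ?_⟩
    have h0 : tmSeq 0 = false := by rw [tmSeq]; rfl
    have h1 : tmSeq 1 = true := by have := tmSeq_odd 0; simpa [h0] using this
    have h2 : tmSeq 2 = true := by have := tmSeq_even 1; simpa [h1] using this
    simp [hWord, hCode, List.range_succ, h0, h1, h2]
  | succ m ih =>
    obtain ⟨N, hN⟩ := ih
    exact ⟨2 * N, by rw [Function.iterate_succ_apply', hWord_muWord, hN, theta_map]⟩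

theorem hCode_cons (a : Fin 3) : ∃ t, hCode a = false :: t := by
  fin_cases a <;> exact ⟨_, rfl⟩

theorem hWord_cons (a : Fin 3) (l : List (Fin 3)) : ∃ t, hWord (a :: l) = false :: t := by
  obtain ⟨t, ht⟩ := hCode_cons a
  exact ⟨t ++ hWord l, by simp [hWord, ht]⟩

theorem no_overlap (N : ℕ) (p w s : List Bool)
    (h : (List.range N).map tmSeq =
      p ++ ((false :: w) ++ ((false :: w) ++ (false :: s)))) : False := by
  have hget : ∀ k b, (p ++ ((false :: w) ++ ((false :: w) ++ (false :: s))))[k]? = some b →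
      tmSeq k = b := by
    intro k b hk
    rw [← h, List.getElem?_map] at hk
    rcases Option.map_eq_some_iff.1 hk with ⟨x, hx, hb⟩
    rw [List.getElem?_eq_some_iff] at hx
    obtain ⟨_, hx⟩ := hx
    rw [List.getElem_range] at hx
    rw [hx, hb]
  refine tmSeq_overlapfree (w.length + 1) (by omega) p.length ?_
  intro j hj
  obtain ⟨b, hb⟩ : ∃ b, ((false :: w) ++ [false])[j]? = some b :=
    ⟨_, List.getElem?_eq_getElem (by simp; omega)⟩
  have a1 : tmSeq (p.length + j) = b := by
    apply hget
    rw [List.getElem?_append_right (by omega), Nat.add_sub_cancel_left]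
    rw [show (false :: w) ++ ((false :: w) ++ (false :: s)) =
      ((false :: w) ++ [false]) ++ (w ++ (false :: s)) by simp]
    rw [List.getElem?_append_left (by simp; omega)]
    exact hb
  have a2 : tmSeq (p.length + (w.length + 1) + j) = b := by
    apply hget
    rw [add_assoc, List.getElem?_append_right (by omega), Nat.add_sub_cancel_left]
    rw [List.getElem?_append_right (by simp)]
    rw [show w.length + 1 + j - (false :: w).length = j by simp]
    rw [show ((false :: w) ++ (false :: s)) = ((false :: w) ++ [false]) ++ s by simp]
    rw [List.getElem?_append_left (by simp; omega)]
    exact hb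
  rw [a1, a2]

theorem no_square_iter (m : ℕ) (p u s : List (Fin 3)) (c : Fin 3) (hu : u ≠ [])
    (h : muWord^[m] [0] = p ++ (u ++ (u ++ (c :: s)))) : False := by
  obtain ⟨N, hN⟩ := hWord_iter m
  obtain ⟨a, u', rfl⟩ := List.exists_cons_of_ne_nil hu
  obtain ⟨w, hw⟩ := hWord_cons a u'
  obtain ⟨t, ht⟩ := hWord_cons c s
  rw [h, hWord_append, hWord_append, hWord_append, hw, ht] at hN
  exact no_overlap N _ _ _ hN.symm

theorem muWord_length (l : List (Fin 3)) : l.length ≤ (muWord l).length := by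
  induction l with
  | nil => simp
  | cons a l ih =>
    have e1 : muWord (a :: l) = mu a ++ muWord l := rfl
    have e2 : 1 ≤ (mu a).length := by fin_cases a <;> simp [mu]
    rw [e1, List.length_append, List.length_cons]
    omega

theorem iter_prefix_succ (m : ℕ) : muWord^[m] [0] <+: muWord^[m + 1] [0] := by
  induction m with
  | zero => exact ⟨[1, 2], rfl⟩
  | succ m ih =>
    obtain ⟨t, ht⟩ := ih
    rw [Function.iterate_succ_apply', Function.iterate_succ_apply' muWord (m + 1), ← ht]
    exact ⟨muWord t, by simp [muWord]⟩

theorem iter_prefix {m k : ℕ} (h : m ≤ k) : muWord^[m] [0] <+: muWord^[k] [0] := by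
  induction k, h using Nat.le_induction with
  | base => exact List.prefix_rfl
  | succ k _ ih => exact ih.trans (iter_prefix_succ k)

theorem iter_length (m : ℕ) : m + 1 ≤ (muWord^[m] [0]).length := by
  induction m with
  | zero => simp
  | succ m ih =>
    obtain ⟨t, ht⟩ := iter_prefix (Nat.zero_le m)
    rw [Function.iterate_succ_apply']
    rw [← ht] at ih ⊢
    have e : muWord (muWord^[0] [0] ++ t) = 0 :: 1 :: 2 :: muWord t := rfl
    have := muWord_length t
    rw [e]
    simp at ih ⊢
    omega

theorem vtm_get {n M : ℕ} (h : n + 1 ≤ M) : (muWord^[M] [0])[n]? = some (vtm n) := by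
  have hl := iter_length (n + 1)
  obtain ⟨t, ht⟩ := iter_prefix h
  rw [← ht, List.getElem?_append_left (by omega), vtm, List.getD_eq_getElem?_getD,
    List.getElem?_eq_getElem (by omega)]
  rfl

/-- The word vtm is squarefree. -/
theorem vtm_squarefree :
    ¬ ∃ (i L : ℕ), 1 ≤ L ∧ ∀ j < L, vtm (i + j) = vtm (i + L + j) := by
  rintro ⟨i, L, hL, h⟩
  have hg : ∀ n, n ≤ i + 2 * L → (muWord^[i + 2 * L + 1] [0])[n]? = some (vtm n) :=
    fun n hn => vtm_get (by omega)
  have hlen := iter_length (i + 2 * L + 1)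
  have key := no_square_iter (i + 2 * L + 1)
  generalize muWord^[i + 2 * L + 1] [0] = W at hg hlen key
  have hu : (W.drop i).take L = (W.drop (i + L)).take L := by
    apply List.ext_getElem?
    intro j
    by_cases hj : j < L
    · rw [List.getElem?_take_of_lt hj, List.getElem?_take_of_lt hj, List.getElem?_drop,
        List.getElem?_drop, hg _ (by omega), hg _ (by omega), h j hj]
    · rw [List.getElem?_eq_none (by simp; omega), List.getElem?_eq_none (by simp; omega)]
  have hne : (W.drop (i + L + L)) ≠ [] := by
    rw [Ne, List.drop_eq_nil_iff]; omega
  obtain ⟨c, s, hcs⟩ := List.exists_cons_of_ne_nil hne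
  refine key (W.take i) ((W.drop i).take L) s c ?_ ?_
  · intro h0
    have := congrArg List.length h0
    simp at this
    omega
  · rw [← hcs]
    nth_rewrite 2 [hu]
    rw [← List.drop_drop (i := L) (j := i + L), List.take_append_drop,
      ← List.drop_drop (i := L) (j := i), List.take_append_drop, List.take_append_drop]
end

section
/- For every ℓ ≥ 1, v_{2^ℓ} = 2. Consequently, for every k that is a power of 2 with k ≥ 2, one has v_k = v_{2k} = 2, so the subsequence (v_{kn})_{n≥0} contains the square 22. -/
theorem muIter_append (m : ℕ) (a b : List (Fin 3)) :
    muWord^[m] (a ++ b) = muWord^[m] a ++ muWord^[m] b := by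
  induction m generalizing a b with
  | zero => rfl
  | succ k ih =>
    simp only [Function.iterate_succ_apply]
    rw [← ih]
    simp [muWord]

theorem muIter_zero (m : ℕ) : muWord^[m + 1] [0] =
    muWord^[m] [0] ++ (muWord^[m] [1] ++ muWord^[m] [2]) := by
  rw [← muIter_append, ← muIter_append, Function.iterate_succ_apply]
  rfl

theorem muIter_one (m : ℕ) : muWord^[m + 1] [1] =
    muWord^[m] [0] ++ muWord^[m] [2] := by
  rw [← muIter_append, Function.iterate_succ_apply]
  rfl

theorem muIter_two (m : ℕ) : muWord^[m + 1] [2] = muWord^[m] [1] := by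
  rw [Function.iterate_succ_apply]
  rfl

theorem muIter_length (m : ℕ) :
    (muWord^[m + 1] [0]).length = 3 * 2 ^ m ∧ (muWord^[m + 1] [1]).length = 2 * 2 ^ m ∧
      (muWord^[m + 1] [2]).length = 2 ^ m := by
  induction m with
  | zero => decide
  | succ k ih =>
    obtain ⟨h0, h1, h2⟩ := ih
    rw [muIter_zero (k + 1), muIter_one (k + 1), muIter_two (k + 1)]
    simp only [List.length_append, h0, h1, h2, pow_succ]
    omega

theorem muIter_get (m : ℕ) : (muWord^[m + 1] [0])[2 ^ (m + 1)]? = some 2 := by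
  induction m using Nat.twoStepInduction with
  | zero => decide
  | one => decide
  | more k ih _ =>
    have hl : (muWord^[k + 2] [0]).length = 3 * 2 ^ (k + 1) := (muIter_length (k + 1)).1
    have hl' := (muIter_length k).1
    rw [muIter_zero (k + 2), muIter_one (k + 1)]
    have e : 2 ^ (k + 2 + 1) = 3 * 2 ^ (k + 1) + 2 ^ (k + 1) := by ring
    have hp : 0 < 2 ^ k := by positivity
    rw [e, List.getElem?_append_right (by omega), hl, Nat.add_sub_cancel_left,
      List.append_assoc, List.getElem?_append_left (by rw [hl', pow_succ]; omega)]
    exact ih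

theorem muIter_prefix (m k : ℕ) : muWord^[m] [0] <+: muWord^[m + k] [0] := by
  induction k with
  | zero => exact List.prefix_rfl
  | succ k ih =>
    refine ih.trans ?_
    rw [← add_assoc, muIter_zero]
    exact List.prefix_append _ _

theorem vtm_two_pow (l : ℕ) (hl : 1 ≤ l) : vtm (2 ^ l) = 2 := by
  obtain ⟨m, rfl⟩ : ∃ m, l = m + 1 := ⟨l - 1, by omega⟩
  have hlt : m + 1 < 2 ^ (m + 1) := Nat.lt_two_pow_self
  obtain ⟨k, hk⟩ : ∃ k, 2 ^ (m + 1) + 1 = (m + 1) + k := ⟨2 ^ (m + 1) - m, by omega⟩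
  obtain ⟨t, ht⟩ := muIter_prefix (m + 1) k
  have hg := muIter_get m
  unfold vtm
  rw [hk, ← ht, List.getD_eq_getElem?_getD, List.getElem?_append_left, hg]
  · rfl
  · exact (List.getElem?_eq_some_iff.1 hg).1

/-- For every ℓ ≥ 1, v_{2^ℓ} = 2; consequently, for every k ≥ 2 that is a power
of 2 one has v_k = v_{2k} = 2, so the subsequence (v_{kn}) contains the square 22. -/
theorem vtm_pow_two :
    (∀ l : ℕ, 1 ≤ l → vtm (2 ^ l) = 2) ∧
    ∀ k : ℕ, 2 ≤ k → (∃ a : ℕ, k = 2 ^ a) →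
      vtm k = 2 ∧ vtm (2 * k) = 2 ∧
      ∃ n : ℕ, vtm (k * n) = 2 ∧ vtm (k * (n + 1)) = 2 := by
  refine ⟨vtm_two_pow, ?_⟩
  rintro k hk ⟨a, rfl⟩
  have ha : 1 ≤ a := by
    rcases Nat.eq_zero_or_pos a with rfl | h
    · norm_num at hk
    · exact h
  have h1 := vtm_two_pow a ha
  have h2 : vtm (2 * 2 ^ a) = 2 := by
    rw [← pow_succ']
    exact vtm_two_pow (a + 1) (by omega)
  refine ⟨h1, h2, 1, by rwa [mul_one], ?_⟩
  rwa [mul_comm]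
end

section
/- For every integer k ≥ 23 and every squarefree infinite word (w_n)_{n≥0} over the alphabet {0,1,2}, there exists a squarefree infinite word (v_n)_{n≥0} over {0,1,2} such that v_{kn} = w_n for all n ≥ 0. (This answers Harju's third problem in the affirmative for every k ≥ 23.) -/
/-- An infinite ternary word is squarefree if it contains no square. -/
def SeqSquarefree (w : ℕ → Fin 3) : Prop :=
  ¬ ∃ (i L : ℕ), 1 ≤ L ∧ ∀ j < L, w (i + j) = w (i + L + j)

/-! Words over `{0,1,2}` are coded as natural numbers in base 3, the first letter being the least
significant digit. -/

/-- The letter at position `i` of the word coded by `W`. -/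
def dig (W i : ℕ) : Fin 3 := Fin.ofNat 3 (W / 3 ^ i)

/-- The code of the factor of length `l` starting at position `i`. -/
def win (W i l : ℕ) : ℕ := Nat.mod (Nat.div W (Nat.pow 3 i)) (Nat.pow 3 l)

lemma win_eq (W i l : ℕ) : win W i l = W / 3 ^ i % 3 ^ l := rfl

/-- Concatenation; `k` is the length of the first word. -/
def cat (k A B : ℕ) : ℕ := Nat.add A (Nat.mul (Nat.pow 3 k) B)

lemma cat_eq (k A B : ℕ) : cat k A B = A + 3 ^ k * B := rfl

/-- `force n f = f n`, but evaluating the left side by reduction computes `n` first. -/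
def force {α : Type} (n : ℕ) (f : ℕ → α) : α :=
  match n with
  | 0 => f 0
  | m + 1 => f (Nat.succ m)

lemma force_eq {α : Type} (n : ℕ) (f : ℕ → α) : force n f = f n := by
  cases n <;> rfl

/-- Bounded universal quantifier. -/
def allB : ℕ → (ℕ → Bool) → Bool
  | 0, _ => true
  | n + 1, f => f n && allB n f

/-- Bounded existential quantifier. -/
def anyB : ℕ → (ℕ → Bool) → Bool
  | 0, _ => false
  | n + 1, f => f n || anyB n f

lemma allB_spec {n : ℕ} {f : ℕ → Bool} (h : allB n f = true) : ∀ i < n, f i = true := by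
  induction n with
  | zero => intro i hi; omega
  | succ n ih =>
    simp only [allB, Bool.and_eq_true] at h
    intro i hi
    rcases Nat.lt_succ_iff_lt_or_eq.mp hi with h1 | h1
    · exact ih h.2 i h1
    · rw [h1]; exact h.1

lemma anyB_spec {n : ℕ} {f : ℕ → Bool} (h : anyB n f = true) : ∃ i < n, f i = true := by
  induction n with
  | zero => simp [anyB] at h
  | succ n ih =>
    simp only [anyB, Bool.or_eq_true] at h
    rcases h with h | h
    · exact ⟨n, by omega, h⟩
    · obtain ⟨i, hi, h2⟩ := ih h
      exact ⟨i, by omega, h2⟩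

lemma win_zero (W i : ℕ) : win W i 0 = 0 := by simp [win_eq, Nat.mod_one]

lemma win_succ (W i l : ℕ) : win W i (l + 1) = (dig W i).val + 3 * win W (i + 1) l := by
  simp only [win_eq, dig]
  rw [pow_succ' 3 l, Nat.mod_mul, pow_succ, ← Nat.div_div_eq_div_mul]
  rfl

lemma win_congr {X Y l : ℕ} : ∀ {p q : ℕ}, (∀ j < l, dig X (p + j) = dig Y (q + j)) →
    win X p l = win Y q l := by
  induction l with
  | zero => intro p q _; simp [win_zero]
  | succ l ih =>
    intro p q h
    rw [win_succ, win_succ]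
    have h0 := h 0 (by omega)
    simp only [add_zero] at h0
    rw [h0, ih (p := p + 1) (q := q + 1)]
    intro j hj
    have := h (j + 1) (by omega)
    rw [show p + 1 + j = p + (j + 1) by omega, show q + 1 + j = q + (j + 1) by omega]
    exact this

lemma dig_of_win {X Y l : ℕ} : ∀ {p q : ℕ}, win X p l = win Y q l →
    ∀ j < l, dig X (p + j) = dig Y (q + j) := by
  induction l with
  | zero => intro p q _ j hj; omega
  | succ l ih =>
    intro p q h j hj
    rw [win_succ, win_succ] at h
    have h1 := (dig X p).isLt
    have h2 := (dig Y q).isLt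
    rcases j with _ | j
    · simp only [add_zero]
      apply Fin.ext
      omega
    · have := ih (p := p + 1) (q := q + 1) (by omega) j (by omega)
      rw [show p + (j + 1) = p + 1 + j by omega, show q + (j + 1) = q + 1 + j by omega]
      exact this

lemma dig_cat_lt {k A B i : ℕ} (h : i < k) : dig (cat k A B) i = dig A i := by
  simp only [dig, cat_eq]
  obtain ⟨e, rfl⟩ : ∃ e, k = i + (e + 1) := ⟨k - i - 1, by omega⟩
  rw [pow_add, mul_assoc, Nat.add_mul_div_left _ _ (by positivity)]
  apply Fin.ext
  simp only [Fin.ofNat, pow_succ']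
  rw [mul_assoc, Nat.add_mul_mod_self_left]

lemma dig_cat_ge {k A B : ℕ} (hA : A < 3 ^ k) (i : ℕ) : dig (cat k A B) (k + i) = dig B i := by
  simp only [dig, cat_eq]
  rw [pow_add, ← Nat.div_div_eq_div_mul, Nat.add_mul_div_left _ _ (by positivity),
    Nat.div_eq_of_lt hA, zero_add]

/-- If `w` is squarefree and is read off from `v` along a progression of difference `k`, then
`v` is squarefree as soon as all periods of squares in `v` are divisible by `k`. -/
lemma sqf_of_dvd {v w : ℕ → Fin 3} {k d : ℕ} (hd : d < k) (hv : ∀ n, v (k * n + d) = w n)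
    (hw : SeqSquarefree w)
    (h : ∀ i L, 1 ≤ L → (∀ j < L, v (i + j) = v (i + L + j)) → k ∣ L) : SeqSquarefree v := by
  rintro ⟨i, L, hL, hs⟩
  obtain ⟨m, rfl⟩ := h i L hL hs
  apply hw
  have hm : 1 ≤ m := by
    rcases m with _ | m
    · simp at hL
    · omega
  set n0 := (i + (k - 1 - d)) / k with hn0
  have h1 : k * n0 + (i + (k - 1 - d)) % k = i + (k - 1 - d) := Nat.div_add_mod _ _
  have h2 : (i + (k - 1 - d)) % k < k := Nat.mod_lt _ (by omega)
  refine ⟨n0, m, hm, fun j hj => ?_⟩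
  have h3 : k * (j + 1) ≤ k * m := Nat.mul_le_mul_left _ hj
  rw [mul_add, mul_one] at h3
  have h4 := hs (k * n0 + d + k * j - i) (by omega)
  rw [← hv, ← hv]
  convert h4 using 2
  · rw [mul_add]; omega
  · rw [mul_add, mul_add]; omega

lemma adj_ne {w : ℕ → Fin 3} (hw : SeqSquarefree w) (n : ℕ) : w n ≠ w (n + 1) := by
  intro h
  apply hw
  refine ⟨n, 1, le_refl _, fun j hj => ?_⟩
  obtain rfl : j = 0 := by omega
  simpa using h

/-- Image of `w` under the uniform morphism `a ↦ B a` of length `k`. -/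
def img (k : ℕ) (B : Fin 3 → ℕ) (w : ℕ → Fin 3) (n : ℕ) : Fin 3 := dig (B (w (n / k))) (n % k)

lemma img_at (k : ℕ) (B : Fin 3 → ℕ) (w : ℕ → Fin 3) (m x : ℕ) (hx : x < k) :
    img k B w (k * m + x) = dig (B (w m)) x := by
  unfold img
  rw [Nat.mul_add_div (by omega), Nat.div_eq_of_lt hx, Nat.mul_add_mod, Nat.mod_eq_of_lt hx,
    add_zero]

lemma img_two {k : ℕ} {B : Fin 3 → ℕ} (hB : ∀ a, B a < 3 ^ k) (w : ℕ → Fin 3) (m x : ℕ)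
    (hx : x < 2 * k) :
    img k B w (k * m + x) = dig (cat k (B (w m)) (B (w (m + 1)))) x := by
  by_cases h : x < k
  · rw [img_at _ _ _ _ _ h, dig_cat_lt h]
  · obtain ⟨y, rfl⟩ : ∃ y, x = k + y := ⟨x - k, by omega⟩
    rw [dig_cat_ge (hB _), ← img_at k B w (m + 1) y (by omega), mul_add, mul_one, add_assoc]

lemma img_three {k : ℕ} {B : Fin 3 → ℕ} (hB : ∀ a, B a < 3 ^ k) (w : ℕ → Fin 3) (m x : ℕ)
    (hx : x < 3 * k) :
    img k B w (k * m + x)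
      = dig (cat k (B (w m)) (cat k (B (w (m + 1))) (B (w (m + 2))))) x := by
  by_cases h : x < k
  · rw [img_at _ _ _ _ _ h, dig_cat_lt h]
  · obtain ⟨y, rfl⟩ : ∃ y, x = k + y := ⟨x - k, by omega⟩
    rw [dig_cat_ge (hB _), ← img_two hB w (m + 1) y (by omega), mul_add, mul_one, add_assoc]

lemma img_four {k : ℕ} {B : Fin 3 → ℕ} (hB : ∀ a, B a < 3 ^ k) (w : ℕ → Fin 3) (m x : ℕ)
    (hx : x < 4 * k) :
    img k B w (k * m + x)
      = dig (cat k (B (w m)) (cat k (B (w (m + 1))) (cat k (B (w (m + 2))) (B (w (m + 3)))))) x := by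
  by_cases h : x < k
  · rw [img_at _ _ _ _ _ h, dig_cat_lt h]
  · obtain ⟨y, rfl⟩ : ∃ y, x = k + y := ⟨x - k, by omega⟩
    rw [dig_cat_ge (hB _), ← img_three hB w (m + 1) y (by omega), mul_add, mul_one, add_assoc]

/-- Choice of one of three words by a letter. -/
def tri (x y z : ℕ) (a : Fin 3) : ℕ :=
  bif Nat.beq a.val 0 then x else bif Nat.beq a.val 1 then y else z

/-- The finite verification for a morphism `a ↦ B a` whose images arise from `B 0` by adding a
constant to all letters: factors of length `s` at a phase in `S` occur at no other phase, any
factor of length `R` contains such a factor, and there are no squares of period below `R`. -/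
def chkBase (k s R : ℕ) (S : List ℕ) (B : Fin 3 → ℕ) : Bool :=
  Nat.ble 1 k && Nat.ble s R && Nat.ble R k &&
  (([0, 1, 2] : List (Fin 3)).all fun a => Nat.blt (B a) (3 ^ k) &&
    allB k fun i => decide (dig (B a) i = dig (B 0) i + a)) &&
  decide (dig (B 0) 0 = 0) &&
  (allB k fun p => anyB (R - s + 1) fun j => S.contains ((p + j) % k)) &&
  (S.all fun c => ([1, 2] : List (Fin 3)).all fun b =>
    force (win (cat k (B 0) (B b)) c s) fun x =>
      ([(0, 1), (0, 2), (1, 0), (1, 2), (2, 0), (2, 1)] : List (Fin 3 × Fin 3)).all fun e =>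
        force (cat k (B e.1) (B e.2)) fun Y =>
          allB k fun q => Nat.beq c q || !(Nat.beq x (win Y q s))) &&
  (([(1, 0), (1, 2), (2, 0), (2, 1)] : List (Fin 3 × Fin 3)).all fun e =>
    force (cat k (B 0) (cat k (B e.1) (B e.2))) fun X =>
      allB k fun p => force (R - 1) fun r => allB r fun l =>
        !(Nat.beq (win X p (l + 1)) (win X (p + (l + 1)) (l + 1))))

lemma img_sub {k : ℕ} {B : Fin 3 → ℕ} (hk : 0 < k)
    (hsh : ∀ a, ∀ i < k, dig (B a) i = dig (B 0) i + a)
    (w : ℕ → Fin 3) (a : Fin 3) (n : ℕ) :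
    img k B (fun m => w m - a) n = img k B w n - a := by
  unfold img
  have h := Nat.mod_lt n hk
  rw [hsh _ _ h, hsh (w (n / k)) _ h, add_sub_assoc]

theorem base_sqf {k s R : ℕ} {S : List ℕ} {B : Fin 3 → ℕ} (hc : chkBase k s R S B = true)
    {w : ℕ → Fin 3} (hw : SeqSquarefree w) :
    SeqSquarefree (img k B w) ∧ ∀ n, img k B w (k * n) = w n := by
  unfold chkBase at hc
  simp only [Bool.and_eq_true, force_eq] at hc
  obtain ⟨⟨⟨⟨⟨⟨⟨hk, hsR⟩, hRk⟩, hB⟩, h0⟩, hhit⟩, hphase⟩, hshort⟩ := hc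
  replace hk : 1 ≤ k := Nat.le_of_ble_eq_true hk
  replace hsR : s ≤ R := Nat.le_of_ble_eq_true hsR
  replace hRk : R ≤ k := Nat.le_of_ble_eq_true hRk
  replace h0 : dig (B 0) 0 = 0 := of_decide_eq_true h0
  rw [List.all_eq_true] at hB hphase hshort
  have hB' : ∀ a : Fin 3, a ∈ ([0, 1, 2] : List (Fin 3)) := by decide
  have hlt : ∀ a, B a < 3 ^ k := fun a => by
    have := hB a (hB' a)
    simp only [Bool.and_eq_true] at this
    simpa [Nat.blt] using this.1
  have hsh : ∀ a, ∀ i < k, dig (B a) i = dig (B 0) i + a := fun a i hi => by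
    have := hB a (hB' a)
    simp only [Bool.and_eq_true] at this
    exact of_decide_eq_true (allB_spec this.2 i hi)
  have hval : ∀ n, img k B w (k * n) = w n := fun n => by
    have := img_at k B w n 0 (by omega)
    rw [add_zero] at this
    rw [this, hsh _ _ (by omega), h0, zero_add]
  refine ⟨sqf_of_dvd (k := k) (d := 0) (by omega) (by simpa using hval) hw ?_, hval⟩
  intro i L hL hsq
  by_cases hLR : L < R
  · exfalso
    set m := i / k with hm
    have him : k * m + i % k = i := Nat.div_add_mod i k
    have hp : i % k < k := Nat.mod_lt _ (by omega)
    have n1 := adj_ne hw m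
    have n2 := adj_ne hw (m + 1)
    have key : ∀ b c d : Fin 3, b ≠ c → c ≠ d →
        (c - b, d - b) ∈ ([(1, 0), (1, 2), (2, 0), (2, 1)] : List (Fin 3 × Fin 3)) := by decide
    have h1 := hshort _ (key _ _ _ n1 n2)
    have h2 := allB_spec (allB_spec h1 (i % k) hp) (L - 1) (by omega)
    rw [show L - 1 + 1 = L by omega] at h2
    have h3 : ∀ x < 3 * k, dig (cat k (B 0) (cat k (B (w (m + 1) - w m))
        (B (w (m + 1 + 1) - w m)))) x = img k B w (k * m + x) - w m := by
      intro x hx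
      rw [← img_sub hk hsh, img_three hlt _ m x hx]
      simp
    have h4 : win (cat k (B 0) (cat k (B (w (m + 1) - w m)) (B (w (m + 1 + 1) - w m)))) (i % k) L
        = win (cat k (B 0) (cat k (B (w (m + 1) - w m)) (B (w (m + 1 + 1) - w m))))
          (i % k + L) L := by
      apply win_congr
      intro j hj
      rw [h3 _ (by omega), h3 _ (by omega)]
      have := hsq j hj
      rw [show k * m + (i % k + j) = i + j by omega,
        show k * m + (i % k + L + j) = i + L + j by omega, this]
    simp only [h4, Nat.beq_refl] at h2
    simp at h2
  · obtain ⟨j, hj, hjS⟩ := anyB_spec (allB_spec hhit (i % k) (Nat.mod_lt _ (by omega)))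
    rw [Nat.mod_add_mod, List.contains_iff_mem] at hjS
    set n := i + j with hn
    set n' := i + L + j with hn'
    have hp : n % k < k := Nat.mod_lt _ (by omega)
    have hq : n' % k < k := Nat.mod_lt _ (by omega)
    have e1 : k * (n / k) + n % k = n := Nat.div_add_mod _ _
    have e2 : k * (n' / k) + n' % k = n' := Nat.div_add_mod _ _
    set m := n / k with hm
    set m' := n' / k with hm'
    have key1 : ∀ b c : Fin 3, b ≠ c → c - b ∈ ([1, 2] : List (Fin 3)) := by decide
    have key2 : ∀ a b c : Fin 3, b ≠ c → (b - a, c - a) ∈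
      ([(0, 1), (0, 2), (1, 0), (1, 2), (2, 0), (2, 1)] : List (Fin 3 × Fin 3)) := by decide
    have h2 := List.all_eq_true.mp (hphase _ hjS) _ (key1 _ _ (adj_ne hw m))
    have h3 := List.all_eq_true.mp h2 _ (key2 (w m) _ _ (adj_ne hw m'))
    have h1 := allB_spec h3 (n' % k) hq
    rw [Bool.or_eq_true] at h1
    rcases h1 with h1 | h1
    · have h2 : n % k = n' % k := Nat.eq_of_beq_eq_true h1
      have h3 : n ≡ n' [MOD k] := h2
      have h4 := (Nat.modEq_iff_dvd' (by omega)).mp h3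
      rwa [show n' - n = L by omega] at h4
    · exfalso
      have a1 : ∀ x < 2 * k, dig (cat k (B 0) (B (w (m + 1) - w m))) x
          = img k B w (k * m + x) - w m := by
        intro x hx
        rw [← img_sub hk hsh, img_two hlt _ m x hx]
        simp
      have a2 : ∀ x < 2 * k, dig (cat k (B (w m' - w m)) (B (w (m' + 1) - w m))) x
          = img k B w (k * m' + x) - w m := by
        intro x hx
        rw [← img_sub hk hsh, img_two hlt _ m' x hx]
      have h4 : win (cat k (B 0) (B (w (m + 1) - w m))) (n % k) s
          = win (cat k (B (w m' - w m)) (B (w (m' + 1) - w m))) (n' % k) s := by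
        apply win_congr
        intro x hx
        rw [a1 _ (by omega), a2 _ (by omega), ← add_assoc, ← add_assoc, e1, e2]
        have := hsq (j + x) (by omega)
        rw [show n + x = i + (j + x) by omega, show n' + x = i + L + (j + x) by omega, this]
      simp only [h4, Nat.beq_refl] at h1
      simp at h1

/-- The 13-uniform squarefree morphism of Leech. -/
def G : Fin 3 → ℕ := tri 320565 933262 1137656

/-- The marker `1202102010` at the beginning of the words `M a`. -/
def f1 : ℕ := 8161

/-- The marker `2021201210` at the end of the words `M a`. -/
def f2 : ℕ := 11873

/-- Image of a word of four letters under `G`. -/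
def G4 (a b c d : Fin 3) : ℕ := cat 13 (G a) (cat 13 (G b) (cat 13 (G c) (G d)))

theorem G_chk : chkBase 13 6 12 [2, 9] G = true := by decide +kernel

theorem G_lt : ∀ a, G a < 3 ^ 13 := by decide +kernel

theorem G_mark : ∀ a b : Fin 3, a ≠ b → ∀ p < 13,
    win (cat 13 (G a) (G b)) p 10 ≠ f1 ∧ win (cat 13 (G a) (G b)) p 10 ≠ f2 := by decide +kernel

/-- Quantification over words of four letters without equal neighbours. -/
def all4 (f : Fin 3 → Fin 3 → Fin 3 → Fin 3 → Bool) : Bool :=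
  ([0, 1, 2] : List (Fin 3)).all fun a => ([0, 1, 2] : List (Fin 3)).all fun b =>
    Nat.beq a.val b.val || (([0, 1, 2] : List (Fin 3)).all fun c =>
      Nat.beq b.val c.val || (([0, 1, 2] : List (Fin 3)).all fun d =>
        Nat.beq c.val d.val || f a b c d))

lemma mem3 : ∀ a : Fin 3, a ∈ ([0, 1, 2] : List (Fin 3)) := by decide

lemma beq_val_false {a b : Fin 3} (h : a ≠ b) : ¬ Nat.beq a.val b.val = true := fun h' =>
  h (Fin.ext (Nat.eq_of_beq_eq_true h'))

lemma all4_spec {f : Fin 3 → Fin 3 → Fin 3 → Fin 3 → Bool} (h : all4 f = true)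
    {a b c d : Fin 3} (hab : a ≠ b) (hbc : b ≠ c) (hcd : c ≠ d) : f a b c d = true := by
  unfold all4 at h
  have h1 := List.all_eq_true.mp (List.all_eq_true.mp h a (mem3 a)) b (mem3 b)
  have h2 := (Bool.or_eq_true _ _ ▸ h1).resolve_left (beq_val_false hab)
  have h3 := List.all_eq_true.mp h2 c (mem3 c)
  have h4 := (Bool.or_eq_true _ _ ▸ h3).resolve_left (beq_val_false hbc)
  have h5 := List.all_eq_true.mp h4 d (mem3 d)
  exact (Bool.or_eq_true _ _ ▸ h5).resolve_left (beq_val_false hcd)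

/-- Are there no squares with center `e` and period in `1, …, n` in the word `X`? -/
def noSq (X e n : ℕ) : Bool :=
  force n fun n' => force e fun e' =>
    allB n' fun l => !(Nat.beq (win X (e' - (l + 1)) (l + 1)) (win X e' (l + 1)))

/-- The finite verification for the words `M a` of length `μ`. -/
def chkM (μ d : ℕ) (M : Fin 3 → ℕ) : Bool :=
  Nat.ble 20 μ && Nat.ble μ 52 && Nat.blt d μ &&
  ([0, 1, 2] : List (Fin 3)).all fun a =>
    Nat.blt (M a) (3 ^ μ) && decide (dig (M a) d = a) &&
    (allB (μ - 9) fun p => (Nat.beq (win (M a) p 10) f1 == Nat.beq p 0) &&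
      (Nat.beq (win (M a) p 10) f2 == Nat.beq p (μ - 10))) &&
    Nat.beq (win (M a) 0 9) (win (G 1) 0 9) && Nat.beq (win (M a) (μ - 9) 9) (win (G 0) 4 9) &&
    (allB μ fun p => allB ((μ - p) / 2) fun l =>
      !(Nat.beq (win (M a) p (l + 1)) (win (M a) (p + (l + 1)) (l + 1)))) &&
    (all4 fun x y z t => Nat.beq t.val 1 ||
      force (cat 52 (G4 x y z t) (M a)) fun X =>
        allB 9 fun e => noSq X (52 + (e + 1)) (μ - (e + 1) - 1)) &&
    (all4 fun x y z t => Nat.beq x.val 0 ||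
      force (cat μ (M a) (G4 x y z t)) fun X =>
        allB 9 fun e => noSq X (μ - 10 + (e + 1)) (μ - 10 + e))

lemma cat_lt {k l A B : ℕ} (hA : A < 3 ^ k) (hB : B < 3 ^ l) : cat k A B < 3 ^ (k + l) := by
  rw [cat_eq]
  rw [pow_add]
  have : 3 ^ k * (B + 1) ≤ 3 ^ k * 3 ^ l := Nat.mul_le_mul_left _ hB
  rw [mul_add, mul_one] at this
  omega

lemma G4_lt (a b c d : Fin 3) : G4 a b c d < 3 ^ 52 :=
  cat_lt (k := 13) (l := 39) (G_lt a) (cat_lt (k := 13) (l := 26) (G_lt b)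
    (cat_lt (k := 13) (l := 13) (G_lt c) (G_lt d)))

lemma noSq_spec {X e n : ℕ} (h : noSq X e n = true) {L : ℕ} (h1 : 1 ≤ L) (h2 : L ≤ n)
    (hs : ∀ j < L, dig X (e - L + j) = dig X (e + j)) : False := by
  simp only [noSq, force_eq] at h
  have h3 := allB_spec h (L - 1) (by omega)
  rw [show L - 1 + 1 = L by omega, win_congr hs, Nat.beq_refl] at h3
  simp at h3

/-- A squarefree word can be cut out of `w` and renamed so that it begins with `0` and has the
letter `1` at position `n + 1`. -/
lemma exists_context {w : ℕ → Fin 3} (hw : SeqSquarefree w) (n : ℕ) :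
    ∃ W : ℕ → Fin 3, SeqSquarefree W ∧ W 0 = 0 ∧ W (n + 1) = 1 := by
  obtain ⟨i, hi⟩ : ∃ i, w i ≠ w (i + (n + 1)) := by
    by_contra! h
    apply hw
    refine ⟨0, n + 1, by omega, fun j _ => ?_⟩
    rw [zero_add, h j]
    congr 1
    omega
  have key : ∀ a b : Fin 3, a ≠ b → ∃ x : Fin 3 × Fin 3 × Fin 3,
      Function.Injective ![x.1, x.2.1, x.2.2] ∧ ![x.1, x.2.1, x.2.2] a = 0 ∧
      ![x.1, x.2.1, x.2.2] b = 1 := by decide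
  obtain ⟨x, hx, h0, h1⟩ := key _ _ hi
  refine ⟨fun m => ![x.1, x.2.1, x.2.2] (w (i + m)), ?_, h0, h1⟩
  rintro ⟨p, L, hL, h⟩
  apply hw
  refine ⟨i + p, L, hL, fun j hj => ?_⟩
  have := hx (h j hj)
  rw [show i + p + j = i + (p + j) by omega, show i + p + L + j = i + (p + L + j) by omega]
  exact this

theorem gen_sqf {μ d N k : ℕ} {M : Fin 3 → ℕ} (hM : chkM μ d M = true)
    (hk : k = μ + 13 * (N + 4)) {w : ℕ → Fin 3} (hw : SeqSquarefree w) :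
    ∃ v : ℕ → Fin 3, SeqSquarefree v ∧ ∀ n : ℕ, v (k * n) = w n := by
  unfold chkM at hM
  simp only [Bool.and_eq_true, force_eq] at hM
  obtain ⟨⟨⟨hμ1, hμ2⟩, hd⟩, hM⟩ := hM
  replace hμ1 : 20 ≤ μ := Nat.le_of_ble_eq_true hμ1
  replace hμ2 : μ ≤ 52 := Nat.le_of_ble_eq_true hμ2
  replace hd : d < μ := by simpa [Nat.blt] using hd
  have hMa := fun a => List.all_eq_true.mp hM a (mem3 a)
  simp only [Bool.and_eq_true] at hMa
  have hMlt : ∀ a, M a < 3 ^ μ := fun a => by simpa [Nat.blt] using (hMa a).1.1.1.1.1.1.1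
  have hMd : ∀ a, dig (M a) d = a := fun a => of_decide_eq_true (hMa a).1.1.1.1.1.1.2
  have hMocc := fun a => (hMa a).1.1.1.1.1.2
  have hMpre : ∀ a, ∀ x < 9, dig (M a) x = dig (G 1) x := fun a x hx => by
    simpa using dig_of_win (Nat.eq_of_beq_eq_true (hMa a).1.1.1.1.2) x hx
  have hMsuf : ∀ a, ∀ x < 9, dig (M a) (μ - 9 + x) = dig (G 0) (4 + x) := fun a x hx =>
    dig_of_win (Nat.eq_of_beq_eq_true (hMa a).1.1.1.2) x hx
  have hMsq := fun a => (hMa a).1.1.2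
  have hMleft := fun a => (hMa a).1.2
  have hMright := fun a => (hMa a).2
  clear hMa hM
  obtain ⟨W, hW, hW0, hW1⟩ := exists_context hw (N + 4)
  obtain ⟨hΓ, -⟩ := base_sqf G_chk hW
  set Γ := img 13 G W with hΓdef
  have hkpos : 0 < k := by omega
  set V : ℕ → Fin 3 := fun x =>
    if x % k < μ then dig (M (w (x / k))) (x % k) else Γ (13 + (x % k - μ)) with hV
  have V_at : ∀ n p, p < k → V (k * n + p) =
      if p < μ then dig (M (w n)) p else Γ (13 + (p - μ)) := by
    intro n p hp
    simp only [hV]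
    rw [Nat.mul_add_div hkpos, Nat.div_eq_of_lt hp, Nat.mul_add_mod, Nat.mod_eq_of_lt hp,
      add_zero]
  have V_M : ∀ n p, p < μ → V (k * n + p) = dig (M (w n)) p := by
    intro n p hp
    rw [V_at n p (by omega), if_pos hp]
  have V_T : ∀ n p, p < 13 * (N + 4) → V (k * n + μ + p) = Γ (13 + p) := by
    intro n p hp
    rw [add_assoc, V_at n (μ + p) (by omega), if_neg (by omega)]
    congr 2
    omega
  have V_Z : ∀ n y, y < 13 * (N + 4) + 18 → V (k * n + (μ - 9) + y) = Γ (4 + y) := by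
    intro n y hy
    by_cases h1 : y < 9
    · rw [add_assoc, V_M n _ (by omega), hMsuf _ _ h1]
      have := img_at 13 G W 0 (4 + y) (by omega)
      rw [mul_zero, zero_add, hW0] at this
      exact this.symm
    · by_cases h2 : y < 13 * (N + 4) + 9
      · have := V_T n (y - 9) (by omega)
        rw [show k * n + (μ - 9) + y = k * n + μ + (y - 9) by omega, this]
        congr 1
        omega
      · have := V_M (n + 1) (y - 9 - 13 * (N + 4)) (by omega)
        rw [mul_add, mul_one] at this
        rw [show k * n + (μ - 9) + y = k * n + k + (y - 9 - 13 * (N + 4)) by omega, this,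
          hMpre _ _ (by omega)]
        have := img_at 13 G W (N + 4 + 1) (y - 9 - 13 * (N + 4)) (by omega)
        rw [hW1] at this
        rw [← this]
        congr 1
        omega
  have V_R : ∀ n x, x < μ + 52 →
      V (k * n + x) = dig (cat μ (M (w n)) (G4 (W 1) (W 2) (W 3) (W 4))) x := by
    intro n x hx
    by_cases h1 : x < μ
    · rw [V_M n x h1, dig_cat_lt h1]
    · obtain ⟨y, rfl⟩ : ∃ y, x = μ + y := ⟨x - μ, by omega⟩
      rw [dig_cat_ge (hMlt _), ← add_assoc, V_T n y (by omega)]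
      exact img_four G_lt W 1 y (by omega)
  have V_L : ∀ n x, x < 52 + μ → V (k * n + (μ + 13 * N) + x) =
      dig (cat 52 (G4 (W (N + 1)) (W (N + 2)) (W (N + 3)) (W (N + 4))) (M (w (n + 1)))) x := by
    intro n x hx
    by_cases h1 : x < 52
    · rw [dig_cat_lt h1, show k * n + (μ + 13 * N) + x = k * n + μ + (13 * N + x) by omega,
        V_T n _ (by omega)]
      have := img_four G_lt W (N + 1) x (by omega)
      rw [show 13 * (N + 1) + x = 13 + (13 * N + x) by omega] at this
      exact this
    · obtain ⟨y, rfl⟩ : ∃ y, x = 52 + y := ⟨x - 52, by omega⟩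
      rw [dig_cat_ge (G4_lt _ _ _ _), ← V_M (n + 1) y (by omega), mul_add]
      congr 1
      omega
  -- occurrences of the markers
  have occ : ∀ f, (f = f1 ∨ f = f2) → ∀ n, (∀ x < 10, V (n + x) = dig f x) →
      n % k ≤ μ - 10 ∧ ∀ a, a = w (n / k) → win (M a) (n % k) 10 = f := by
    intro f hf n h
    have e1 : k * (n / k) + n % k = n := Nat.div_add_mod _ _
    have e2 : n % k < k := Nat.mod_lt _ hkpos
    have hf10 : win f 0 10 = f := by rcases hf with rfl | rfl <;> decide
    set m := n / k with hm
    set p := n % k with hp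
    have h1 : p ≤ μ - 10 := by
      by_contra hcon
      set y := p - (μ - 9) with hy
      have e3 : 13 * ((4 + y) / 13) + (4 + y) % 13 = 4 + y := Nat.div_add_mod _ _
      have e4 : (4 + y) % 13 < 13 := Nat.mod_lt _ (by omega)
      have h2 := G_mark _ _ (adj_ne hW ((4 + y) / 13)) _ e4
      have h3 : win (cat 13 (G (W ((4 + y) / 13))) (G (W ((4 + y) / 13 + 1))))
          ((4 + y) % 13) 10 = f := by
        rw [← hf10]
        apply win_congr
        intro x hx
        rw [zero_add, ← h x hx, ← img_two G_lt W _ _ (by omega), ← add_assoc, e3, add_assoc]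
        rw [← hΓdef, ← V_Z m (y + x) (by omega)]
        congr 1
        omega
      rcases hf with rfl | rfl
      · exact h2.1 h3
      · exact h2.2 h3
    refine ⟨h1, ?_⟩
    rintro a rfl
    rw [← hf10]
    apply win_congr
    intro x hx
    rw [zero_add, ← h x hx, ← V_M m _ (by omega), ← add_assoc, e1]
  have occ1 : ∀ n, (∀ x < 10, V (n + x) = dig f1 x) → n % k = 0 := by
    intro n h
    obtain ⟨h1, h2⟩ := occ f1 (Or.inl rfl) n h
    have h3 := allB_spec (hMocc (w (n / k))) (n % k) (by omega)
    rw [h2 _ rfl] at h3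
    simp only [Bool.and_eq_true, Nat.beq_refl, beq_iff_eq] at h3
    exact Nat.eq_of_beq_eq_true h3.1.symm
  have occ2 : ∀ n, (∀ x < 10, V (n + x) = dig f2 x) → n % k = μ - 10 := by
    intro n h
    obtain ⟨h1, h2⟩ := occ f2 (Or.inr rfl) n h
    have h3 := allB_spec (hMocc (w (n / k))) (n % k) (by omega)
    rw [h2 _ rfl] at h3
    simp only [Bool.and_eq_true, Nat.beq_refl, beq_iff_eq] at h3
    exact Nat.eq_of_beq_eq_true h3.2.symm
  have is1 : ∀ n, ∀ x < 10, V (k * n + x) = dig f1 x := by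
    intro n x hx
    have h3 := allB_spec (hMocc (w n)) 0 (by omega)
    simp only [Bool.and_eq_true, Nat.beq_refl, beq_iff_eq] at h3
    have h4 : win (M (w n)) 0 10 = win f1 0 10 := by
      rw [Nat.eq_of_beq_eq_true h3.1]; decide
    have h5 := dig_of_win h4 x hx
    rw [zero_add] at h5
    rw [V_M n x (by omega), h5]
  have is2 : ∀ n, ∀ x < 10, V (k * n + (μ - 10) + x) = dig f2 x := by
    intro n x hx
    have h3 := allB_spec (hMocc (w n)) (μ - 10) (by omega)
    simp only [Bool.and_eq_true, Nat.beq_refl, beq_iff_eq] at h3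
    have h4 : win (M (w n)) (μ - 10) 10 = win f2 0 10 := by
      rw [Nat.eq_of_beq_eq_true h3.2]; decide
    have h5 := dig_of_win h4 x hx
    rw [zero_add] at h5
    rw [add_assoc, V_M n _ (by omega), h5]
  have main : SeqSquarefree V := by
    refine sqf_of_dvd (k := k) (d := d) (w := w) (by omega) (fun n => ?_) hw ?_
    · rw [V_M n d hd, hMd]
    intro i L hL hsq
    by_contra hdvd
    -- markers inside the square contain its center
    have mk1 : ∀ n, i ≤ k * n → k * n + 10 ≤ i + 2 * L → k * n < i + L ∧ i + L < k * n + 10 := by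
      intro n h1 h2
      by_contra hcon
      apply hdvd
      rcases (by omega : k * n + 10 ≤ i + L ∨ i + L ≤ k * n) with h3 | h3
      · have := occ1 (k * n + L) (fun x hx => by
          rw [← is1 n x hx]
          have := hsq (k * n - i + x) (by omega)
          rw [show k * n + x = i + (k * n - i + x) by omega, this]
          congr 1
          omega)
        rw [Nat.mul_add_mod] at this
        exact Nat.dvd_of_mod_eq_zero this
      · have := occ1 (k * n - L) (fun x hx => by
          rw [← is1 n x hx]
          have := hsq (k * n - L - i + x) (by omega)
          rw [show k * n - L + x = i + (k * n - L - i + x) by omega, this]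
          congr 1
          omega)
        have h4 : k ∣ k * n - L := Nat.dvd_of_mod_eq_zero this
        have h5 := Nat.dvd_sub (Nat.dvd_mul_right k n) h4
        rwa [show k * n - (k * n - L) = L by omega] at h5
    have mk2 : ∀ n, i ≤ k * n + (μ - 10) → k * n + μ ≤ i + 2 * L →
        k * n + (μ - 10) < i + L ∧ i + L < k * n + μ := by
      intro n h1 h2
      by_contra hcon
      apply hdvd
      have e0 : (k * n + (μ - 10)) % k = μ - 10 := by
        rw [Nat.mul_add_mod, Nat.mod_eq_of_lt (by omega)]
      rcases (by omega : k * n + μ ≤ i + L ∨ i + L ≤ k * n + (μ - 10)) with h3 | h3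
      · have := occ2 (k * n + (μ - 10) + L) (fun x hx => by
          rw [← is2 n x hx]
          have := hsq (k * n + (μ - 10) - i + x) (by omega)
          rw [show k * n + (μ - 10) + x = i + (k * n + (μ - 10) - i + x) by omega, this]
          congr 1
          omega)
        have h4 : (k * n + (μ - 10)) ≡ k * n + (μ - 10) + L [MOD k] := by
          unfold Nat.ModEq; rw [this, e0]
        have h5 := (Nat.modEq_iff_dvd' (by omega)).mp h4
        rwa [show k * n + (μ - 10) + L - (k * n + (μ - 10)) = L by omega] at h5
      · have := occ2 (k * n + (μ - 10) - L) (fun x hx => by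
          rw [← is2 n x hx]
          have := hsq (k * n + (μ - 10) - L - i + x) (by omega)
          rw [show k * n + (μ - 10) - L + x = i + (k * n + (μ - 10) - L - i + x) by omega, this]
          congr 1
          omega)
        have h4 : (k * n + (μ - 10) - L) ≡ k * n + (μ - 10) [MOD k] := by
          unfold Nat.ModEq; rw [this, e0]
        have h5 := (Nat.modEq_iff_dvd' (by omega)).mp h4
        rwa [show k * n + (μ - 10) - (k * n + (μ - 10) - L) = L by omega] at h5
    -- no square inside a word `M a`
    have inM : ∀ n, k * n ≤ i → i + 2 * L ≤ k * n + μ → False := by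
      intro n h1 h2
      have h3 := allB_spec (allB_spec (hMsq (w n)) (i - k * n) (by omega)) (L - 1) (by omega)
      rw [show L - 1 + 1 = L by omega] at h3
      have h4 : win (M (w n)) (i - k * n) L = win (M (w n)) (i - k * n + L) L := by
        apply win_congr
        intro j hj
        rw [← V_M n _ (by omega), ← V_M n _ (by omega)]
        have := hsq j hj
        rw [show k * n + (i - k * n + j) = i + j by omega, this]
        congr 1
        omega
      rw [h4, Nat.beq_refl] at h3
      simp at h3
    -- case A
    have caseA : ∀ n, i ≤ k * n → k * n + 10 ≤ i + 2 * L → False := by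
      intro n h1 h2
      obtain ⟨h3, h4⟩ := mk1 n h1 h2
      have h5 : i + 2 * L < k * n + μ := by
        by_contra hcon
        have := mk2 n (by omega) (by omega)
        omega
      rcases Nat.eq_or_lt_of_le h1 with h6 | h6
      · exact inM n (by omega) (by omega)
      · obtain ⟨m, rfl⟩ : ∃ m, n = m + 1 := by
          rcases n with _ | m
          · simp at h6
          · exact ⟨m, rfl⟩
        have ht : W (N + 4) ≠ 1 := by
          have := adj_ne hW (N + 4)
          rwa [hW1] at this
        have h7 := all4_spec (hMleft (w (m + 1))) (adj_ne hW (N + 1)) (adj_ne hW (N + 2))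
          (adj_ne hW (N + 3))
        have h8 := (Bool.or_eq_true _ _ ▸ h7).resolve_left (beq_val_false ht)
        have hkm : k * (m + 1) = k * m + k := by rw [mul_add, mul_one]
        have h9 := allB_spec h8 (i + L - k * (m + 1) - 1) (by omega)
        rw [show i + L - k * (m + 1) - 1 + 1 = i + L - k * (m + 1) by omega] at h9
        refine noSq_spec h9 (L := L) hL (by omega) ?_
        intro j hj
        have q1 := V_L m (52 + (i + L - k * (m + 1)) - L + j) (by omega)
        have q2 := V_L m (52 + (i + L - k * (m + 1)) + j) (by omega)
        refine q1.symm.trans (Eq.trans ?_ q2)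
        have := hsq j hj
        rw [show k * m + (μ + 13 * N) + (52 + (i + L - k * (m + 1)) - L + j) = i + j by omega,
          this]
        congr 1
        omega
    -- case B
    have caseB : ∀ n, i ≤ k * n + (μ - 10) → k * n + μ ≤ i + 2 * L → False := by
      intro n h1 h2
      obtain ⟨h3, h4⟩ := mk2 n h1 h2
      have h5 : k * n < i := by
        by_contra hcon
        have := mk1 n (by omega) (by omega)
        omega
      have ht : W 1 ≠ 0 := by
        have := adj_ne hW 0
        rw [hW0] at this
        exact this.symm
      have h7 := all4_spec (hMright (w n)) (adj_ne hW 1) (adj_ne hW 2) (adj_ne hW 3)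
      have h8 := (Bool.or_eq_true _ _ ▸ h7).resolve_left (beq_val_false ht)
      have h9 := allB_spec h8 (i + L - k * n - (μ - 10) - 1) (by omega)
      rw [show μ - 10 + (i + L - k * n - (μ - 10) - 1 + 1) = i + L - k * n by omega] at h9
      refine noSq_spec h9 (L := L) hL (by omega) ?_
      intro j hj
      have q1 := V_R n (i + L - k * n - L + j) (by omega)
      have q2 := V_R n (i + L - k * n + j) (by omega)
      refine q1.symm.trans (Eq.trans ?_ q2)
      have := hsq j hj
      rw [show k * n + (i + L - k * n - L + j) = i + j by omega, this]
      congr 1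
      omega
    -- remaining cases
    have e1 : k * (i / k) + i % k = i := Nat.div_add_mod _ _
    have e2 : i % k < k := Nat.mod_lt _ hkpos
    set n := i / k with hn
    by_cases c1 : i % k ≤ μ - 10
    · by_cases c2 : k * n + μ ≤ i + 2 * L
      · exact caseB n (by omega) c2
      · exact inM n (by omega) (by omega)
    · by_cases c2 : k * (n + 1) + 10 ≤ i + 2 * L
      · exact caseA (n + 1) (by rw [mul_add]; omega) c2
      · rw [mul_add, mul_one] at c2
        apply hΓ
        refine ⟨4 + (i % k - (μ - 9)), L, hL, fun j hj => ?_⟩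
        have q1 := V_Z n (i % k - (μ - 9) + j) (by omega)
        have q2 := V_Z n (i % k - (μ - 9) + L + j) (by omega)
        rw [show 4 + (i % k - (μ - 9)) + j = 4 + (i % k - (μ - 9) + j) by omega,
          show 4 + (i % k - (μ - 9)) + L + j = 4 + (i % k - (μ - 9) + L + j) by omega,
          ← q1, ← q2]
        have := hsq j hj
        rw [show k * n + (μ - 9) + (i % k - (μ - 9) + j) = i + j by omega, this]
        congr 1
        omega
  refine ⟨fun n => V (n + d), ?_, fun n => ?_⟩
  · rintro ⟨i, L, hL, h⟩
    apply main
    refine ⟨i + d, L, hL, fun j hj => ?_⟩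
    have := h j hj
    simp only at this
    rw [show i + d + j = i + j + d by omega, show i + d + L + j = i + L + j + d by omega, this]
  · simp only
    rw [V_M n d hd, hMd]

/-- Rows `(k, s, R, S, B 0, B 1, B 2)` for the lengths `23 ≤ k < 92`. -/
def baseTable : List (ℕ × ℕ × ℕ × List ℕ × ℕ × ℕ × ℕ) := [
  (23, 7, 14, [0, 8, 16],
    18930032472,
    55105952137,
    67178783630),
  (24, 9, 16, [6, 14, 22],
    56787229191,
    165324693418,
    201532382111),
  (25, 8, 16, [3, 12, 21],
    165317856411,
    483965887372,
    621649170380),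
  (26, 8, 20, [9, 22],
    511111576551,
    1487858231968,
    1813828933973),
  (27, 10, 18, [4, 13, 22],
    1487858208924,
    4355694793753,
    5594843224802),
  (28, 10, 23, [10, 24],
    4478503388997,
    13060830808996,
    16775854484447),
  (29, 8, 18, [7, 14, 25],
    13435430729196,
    39182379867619,
    50327755450508),
  (30, 9, 18, [9, 19, 29],
    40312103435022,
    117545977636324,
    150978617070626),
  (31, 8, 18, [5, 16, 27],
    124199924237481,
    361550176320328,
    440759993868110),
  (32, 8, 23, [5, 21],
    372581011042716,
    1084695313950124,
    1322253958284920),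
  (33, 8, 18, [2, 13, 24],
    1088429636660475,
    3173736482124757,
    4076424731048051),
  (34, 8, 24, [0, 17],
    3264810171453102,
    9521319625253521,
    12229642752793229),
  (35, 8, 19, [0, 12, 23],
    9794539170434289,
    28563995353126912,
    36688783124938358),
  (36, 9, 17, [7, 16, 25, 34],
    30177708988807605,
    87860683022765857,
    107103560933925218),
  (37, 8, 20, [2, 14, 26],
    128976192345993864,
    186702950279118268,
    359746716211383911),
  (38, 9, 21, [2, 15, 27],
    386918410027487460,
    560106308352906109,
    1079252858129094563),
  (39, 9, 21, [2, 15, 28],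
    790708868293054386,
    2314794779490273163,
    2973329081745136850),
  (40, 9, 18, [3, 13, 23, 33],
    2444627477167836249,
    7116391641722045164,
    8675479069695511787),
  (41, 8, 21, [4, 18, 31],
    7333169212185955941,
    21350126034921148513,
    26026199318649075149),
  (42, 10, 23, [0, 14, 28],
    21420657276327798681,
    62469457361968053256,
    80238369058972686875),
  (43, 9, 19, [1, 12, 22, 33],
    64270604186432041368,
    187405932076187731918,
    240708914829185843153),
  (44, 10, 20, [1, 12, 23, 34],
    282070936344083900613,
    408319339838617080604,
    786766077092715868103),
  (45, 8, 22, [11, 26, 41],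
    578351237255174572716,
    1686672978509900834692,
    2166444844061175140555),
  (46, 10, 21, [0, 12, 24, 34],
    1735053982333014079767,
    5060019622963201943542,
    6499333574182535620583),
  (47, 10, 21, [2, 14, 26, 38],
    5187849852993270071412,
    15187362279748382361427,
    19508009405694602498840),
  (48, 11, 22, [11, 23, 35, 47],
    15617734848465622811445,
    45539720021709979270261,
    58492209745133162713334),
  (49, 9, 21, [7, 20, 33, 45],
    68539707662589004983729,
    99227625326787061104085,
    191181660856550228297309),
  (50, 10, 19, [0, 10, 20, 30, 40],
    191454050688958071081303,
    308035874821393325973934,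
    577357056027427486100135),
  (51, 9, 25, [5, 22, 39],
    574361697482303553334059,
    924105831861842216182405,
    1732073415269190879949655),
  (52, 9, 22, [12, 25, 36, 50],
    1265036523027602772201402,
    3688717321581764720485642,
    4737868989230642455711316),
  (53, 9, 22, [2, 16, 30, 44],
    3795114905881172805369378,
    11066132886281764717421887,
    14213620709357092322403818),
  (54, 10, 23, [1, 15, 29, 43],
    11691462776307348280891656,
    34039028779758344051369440,
    41494113948494397203324156),
  (55, 10, 23, [0, 14, 28, 41],
    49832768379471590890292064,
    72363723310272517252266160,
    139477324823936160464197535),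
  (56, 10, 23, [2, 16, 30, 44],
    105227934939984377266729509,
    306349816403993761468071538,
    373443698197062667085466233),
  (57, 9, 23, [9, 23, 38, 53],
    307403833977101551147805892,
    896358368000040317866401028,
    1151302146645980548446594923),
  (58, 9, 23, [2, 16, 31, 46],
    947008486441965089410983120,
    2757161331675154693760771752,
    3361023227752247469210650660),
  (59, 10, 24, [9, 24, 39, 54],
    3768666771924899642981985261,
    6063160779738345713747107519,
    11363751585944856400418123819),
  (60, 10, 24, [5, 20, 35, 50],
    11305170097826535345066722043,
    18189210556477890305684071669,
    34092356758519879620690856088),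
  (61, 8, 28, [2, 23, 44],
    36328088148610621687111902318,
    52753154293270164916301183929,
    101678969796592129210911863156),
  (62, 10, 25, [1, 17, 33, 49],
    101746451629131118282352589315,
    163702575798416525249127930286,
    306831609287871103911494328611),
  (63, 9, 29, [10, 31, 52],
    224097424891292341245299403693,
    653445207397554563049727720795,
    839299277857409338033897420151),
  (64, 11, 26, [3, 19, 35, 51],
    669959776004510955170463757482,
    1961298440506660038848572575292,
    2519267513927597732967737301146),
  (65, 10, 26, [5, 20, 37, 54],
    2950409538928085950940317292598,
    4271424005946636507812962029310,
    8229743646441583722207041579855),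
  (66, 10, 26, [3, 20, 37, 54],
    6213601219046956570608549561012,
    18089660839649241109527764277235,
    22051469515252720862744648867045),
  (67, 11, 27, [12, 29, 45, 62],
    18151888900414341836233732138392,
    52929065241309888762068553592354,
    67983240580122525030340602385133),
  (68, 11, 27, [6, 23, 40, 57],
    54455750836251793964690349758601,
    158786911633110789534408316546540,
    203949921696177683386829998042499),
  (69, 12, 25, [1, 14, 28, 42, 56],
    167267012380652943351228213243318,
    488273470380510951682770666236332,
    596037269735456905623787113563273),
  (70, 10, 27, [0, 18, 36, 52],
    716969931392725305498066663649095,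
    1037886941507900052358639525519459,
    1999876384589237044116651789960218),
  (71, 11, 28, [3, 21, 38, 56],
    1470107783765446917729335520834081,
    4287302462632406690323670834895442,
    5506789526071733597867067581656796),
  (72, 11, 25, [1, 14, 29, 44, 59],
    4410323376833494851503935153918971,
    12861907297595551405352219229720286,
    16520368642979715360904067428519703),
  (73, 8, 32, [10, 34, 58],
    18023889572079035002649040862489191,
    28999530966045341387291218523703145,
    54354377414101908463340406050284547),
  (74, 11, 25, [10, 25, 40, 55, 70],
    39562251210993709362154409107712157,
    115812209132560127732292633836565043,
    148758933513125017465394953365153452),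
  (75, 12, 26, [0, 15, 30, 45, 60],
    119078095216022247810981255782641824,
    347272005754152735205703983168394932,
    446050080599861580662840749977255203),
  (76, 11, 26, [9, 25, 41, 57, 69],
    356044118291012457608237198379346674,
    1042314344692993175752604708653503598,
    1338842081726104057677736059752025608),
  (77, 10, 25, [4, 20, 34, 49, 65],
    1459935670825300469315836321170541572,
    2348961578042793373741045750695960886,
    4402704385262235230058851828488125185),
  (78, 11, 26, [3, 17, 33, 49, 65],
    4704148207809185157473632870282769013,
    6809616037635577719414188121872612218,
    13121040656946224342459380708908501701),
  (79, 12, 27, [0, 16, 32, 48, 63],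
    9646671214486324656006684969629419275,
    28128626015818503354951067729001102734,
    36129117476868133647083852404561126790),
  (80, 12, 27, [4, 20, 36, 52, 68],
    28839569618561846739396053208946713795,
    84427467213584794618876962285976197004,
    108446207289372243615851799814652035601),
  (81, 11, 27, [1, 18, 35, 51, 67],
    86522563280501486158794289536065977974,
    253281437576655730614202132815443133973,
    325335731507399438149378023577215727256),
  (82, 10, 30, [3, 24, 43, 64],
    381026043667638974735695405218879352509,
    551576354883983605225665943479937188082,
    1062816798542047384805761989087357977021),
  (83, 11, 27, [3, 20, 37, 53, 70],
    802465879087723474665180170864453001279,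
    2336005293492109296340906836717503913118,
    2847786418701177123295283005776566638442),
  (84, 12, 28, [2, 19, 36, 53, 70],
    3193148428971146291813862038806251683943,
    5137247065327075314097276284954290419579,
    9628377279544808076992971716315028554998),
  (85, 12, 28, [6, 23, 40, 57, 74],
    9579419412130465627833543178896853628085,
    15411777902667377001125031324084238481797,
    28885121006731246419753755617245619865681),
  (86, 10, 28, [6, 25, 36, 55, 74],
    21665488892834000186548578512012621363511,
    63074745820131152680348191261554365777192,
    76888720251622114279240220587113148785989),
  (87, 11, 32, [3, 25, 47, 69],
    63072138755849209706527658530406871844224,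
    184642870796038672680236838952816575421981,
    237171855341873919051646473598816960513874),
  (88, 12, 29, [13, 31, 49, 67, 85],
    189847852836171480733752876341445935591478,
    553662232128619198479596991403066027184431,
    711150509716494725101883045501609260564331),
  (89, 11, 28, [5, 23, 41, 58, 76],
    775935068163123863976775181188011231928818,
    1248351037006716231136536444132633267443401,
    2339695678874016117832387114417719170648504),
  (90, 12, 29, [11, 29, 47, 65, 83],
    1754905390874788252062427081672367875554579,
    5109051551828902747648967725902577085963533,
    6227988409427877639125701411640146048544060),
  (91, 11, 29, [1, 20, 39, 54, 73],
    5264986632820361364516936222035053364013768,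
    15326504247070736353907993045015425072866238,
    18684345176503608198086359390594794593306513)]

/-- Rows `(μ, d, M 0, M 1, M 2)`, one for each residue class modulo 13. -/
def markTable : List (ℕ × ℕ × ℕ × ℕ × ℕ) := [
  (40, 15,
    2444627477318967763,
    2444630382255189913,
    2444630383598672761),
  (41, 15,
    7333892452774843135,
    7333892357273832553,
    7333882431742125754),
  (42, 15,
    22001643922939270018,
    22001677435041151030,
    22001677354251490210),
  (43, 15,
    66005032074972755290,
    66005019882304707994,
    66005032062986103535),
  (44, 15,
    198014796265657898311,
    198014795809506144781,
    198015096915603360385),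
  (45, 15,
    594044387428495507009,
    594045288689657696089,
    594044476988513332543),
  (46, 15,
    1782135549643265770183,
    1782135536836923668311,
    1782133157745995014042),
  (47, 16,
    5346406610873990658304,
    5346400292896748300125,
    5346406648929860476657),
  (48, 16,
    16039198460977307038051,
    16039198419714083433616,
    16039200878690308066483),
  (49, 16,
    48117595492595371385671,
    48117602634644978638990,
    48117595259142313466956),
  (50, 16,
    144352979520996954865732,
    144352786477555963459213,
    144352807903934999083078),
  (51, 16,
    433058935477528968659161,
    433059015365236716860131,
    433058359432667953543747),
  (52, 21,
    1299175071996840831104119,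
    1299177046095710213746501,
    1299177050863258539052981)]

/-- Verification of a row of `baseTable`. -/
def baseRow : ℕ × ℕ × ℕ × List ℕ × ℕ × ℕ × ℕ → Bool
  | (k, s, R, S, x, y, z) => chkBase k s R S (tri x y z)

/-- Verification of a row of `markTable`. -/
def markRow : ℕ × ℕ × ℕ × ℕ × ℕ → Bool
  | (μ, d, x, y, z) => chkM μ d (tri x y z)

theorem baseTable_chk : baseTable.all baseRow = true := by decide +kernel

theorem markTable_chk : markTable.all markRow = true := by decide +kernel

theorem baseTable_len : baseTable.map (fun r => r.1) = List.range' 23 69 := by decide +kernel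

theorem markTable_len : markTable.map (fun r => r.1) = List.range' 40 13 := by decide +kernel

/-- For every k ≥ 23, every squarefree infinite ternary word w arises as the
arithmetic subsequence with difference k of some squarefree infinite ternary word. -/
theorem harju_third_problem (k : ℕ) (hk : 23 ≤ k) (w : ℕ → Fin 3)
    (hw : SeqSquarefree w) :
    ∃ v : ℕ → Fin 3, SeqSquarefree v ∧ ∀ n : ℕ, v (k * n) = w n := by
  by_cases h : k < 92
  · have h1 : k ∈ baseTable.map (fun r => r.1) := by
      rw [baseTable_len, List.mem_range'_1]
      omega
    obtain ⟨r, hr, rfl⟩ := List.mem_map.mp h1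
    exact ⟨_, base_sqf (List.all_eq_true.mp baseTable_chk r hr) hw⟩
  · have h1 : 40 + (k - 40) % 13 ∈ markTable.map (fun r => r.1) := by
      rw [markTable_len, List.mem_range'_1]
      omega
    obtain ⟨r, hr, h2⟩ := List.mem_map.mp h1
    refine gen_sqf (N := (k - 40) / 13 - 4) (List.all_eq_true.mp markTable_chk r hr) ?_ hw
    rw [h2]
    omega
end
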